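/- Let X be any set of languages (subsets of {0,1}*) and suppose there is a permutation martingale d that succeeds on every permutation in Π_X. Then there is a (classical) martingale D that succeeds on every language L ∈ X. -/

import Mathlib

open Filter MeasureTheory

/-- Binary strings. -/
abbrev Str := List Bool

/-- The standard length-lexicographic enumeration `s_0 = λ, s_1 = 0, s_2 = 1, s_3 = 00, …`
of binary strings: `stdEnum n` is the binary representation of `n+1` with the leading 1 removed. -/
def stdEnum (n : ℕ) : Str := ((n + 1).bits.dropLast).reverse

/-- The set Π of length-preserving permutations of `{0,1}*`. -/
structure LPPerm where
  toFun : Str → Str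
  bij : Function.Bijective toFun
  lenPres : ∀ x, (toFun x).length = x.length

/-- `g` is a prefix partial permutation: a finite list of pairwise distinct binary strings
with `|g(s_i)| = |s_i|` for all `i < |g|`. -/
def IsPPP (g : List Str) : Prop :=
  g.Nodup ∧ ∀ i (h : i < g.length), (g.get ⟨i, h⟩).length = (stdEnum i).length

/-- The finite set of binary strings of length `n`. -/
def strsOfLen (n : ℕ) : Finset Str :=
  (Finset.univ : Finset (Fin n → Bool)).image List.ofFn

/-- `free(g)`: strings of length `|s_{|g|}|` that do not occur as entries of `g`. -/
def freeSet (g : List Str) : Finset Str :=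
  (strsOfLen (stdEnum g.length).length).filter (fun x => x ∉ g)

/-- A permutation martingale: nonnegative and satisfying the averaging condition
`d(g) = (1/|free(g)|) · Σ_{x ∈ free(g)} d((g,x))` on prefix partial permutations. -/
def IsPermMartingale (d : List Str → ℝ) : Prop :=
  (∀ g, 0 ≤ d g) ∧
    ∀ g, IsPPP g → d g = (1 / ((freeSet g).card : ℝ)) * ∑ x ∈ freeSet g, d (g ++ [x])

/-- The cylinder measure `μ(g) = (∏_{k<n} 1/(2^k)!) · (2^n − m)!/(2^n)!` where
`2^n − 1 ≤ |g| < 2^{n+1} − 1` (so `n = log2(|g|+1)`) and `m = |g| − (2^n − 1)`. -/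
noncomputable def muPPP (g : List Str) : ℝ :=
  (∏ k ∈ Finset.range (Nat.log2 (g.length + 1)), (1 : ℝ) / (Nat.factorial (2 ^ k))) *
      (Nat.factorial
        (2 ^ Nat.log2 (g.length + 1) - (g.length - (2 ^ Nat.log2 (g.length + 1) - 1)))) /
      (Nat.factorial (2 ^ Nat.log2 (g.length + 1)))

/-- The cylinder of all permutations extending the prefix partial permutation `g`. -/
def cyl (g : List Str) : Set LPPerm :=
  {π | ∀ i (h : i < g.length), π.toFun (stdEnum i) = g.get ⟨i, h⟩}

/-- The σ-algebra `F_Π` generated by the cylinders. -/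
instance : MeasurableSpace LPPerm :=
  MeasurableSpace.generateFrom {S | ∃ g, IsPPP g ∧ S = cyl g}

/-- `π↾N = [π(s_0), …, π(s_{N−1})]`. -/
def LPPerm.restrict (π : LPPerm) (N : ℕ) : List Str :=
  (List.range N).map (fun i => π.toFun (stdEnum i))

/-- `d` succeeds on `π`: `limsup_{N→∞} d(π↾N) = ∞`. -/
def succeedsOn (d : List Str → ℝ) (π : LPPerm) : Prop :=
  ∀ C : ℝ, ∃ᶠ N in atTop, C < d (π.restrict N)

open Classical in
/-- `A↾n`: the length-`n` prefix of the characteristic sequence of the language `A`. -/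
noncomputable def charPrefix (A : Set Str) (n : ℕ) : List Bool :=
  (List.range n).map (fun i => if stdEnum i ∈ A then true else false)

/-- A classical martingale: nonnegative with `D(w) = (D(w0) + D(w1))/2`. -/
def IsMartingale (D : List Bool → ℝ) : Prop :=
  (∀ w, 0 ≤ D w) ∧ ∀ w, D w = (D (w ++ [false]) + D (w ++ [true])) / 2

/-- A classical martingale succeeds on a language `A` if `limsup_{n→∞} D(A↾n) = ∞`. -/
def succeedsOnLang (D : List Bool → ℝ) (A : Set Str) : Prop :=
  ∀ C : ℝ, ∃ᶠ n in atTop, C < D (charPrefix A n)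

/-- `Π_L`: the permutations `π` such that for all `n > 0` and `x ∈ {0,1}^n`, the first bit
of `π(0^{2n}x)` is 1 iff `x ∈ L`. -/
def PiL (L : Set Str) : Set LPPerm :=
  {π | ∀ n : ℕ, 0 < n → ∀ x : Str, x.length = n →
      ((π.toFun (List.replicate (2 * n) false ++ x)).head? = some true ↔ x ∈ L)}

/-- `Π_X = ∪_{L ∈ X} Π_L`. -/
def PiX (X : Set (Set Str)) : Set LPPerm := ⋃ L ∈ X, PiL L

theorem stdEnum_zero : stdEnum 0 = [] := by simp [stdEnum]

theorem bits_succ_ne_nil (i : ℕ) : (i + 1).bits ≠ [] := by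
  intro h
  have := Nat.size_eq_bits_len (i + 1)
  rw [h, List.length_nil, eq_comm, Nat.size_eq_zero] at this
  omega

theorem log2_one : Nat.log2 1 = 0 := by
  rw [Nat.log2_eq_log_two, Nat.log_one_right]

theorem stdEnum_bit0 (i : ℕ) : stdEnum (2 * i + 1) = stdEnum i ++ [false] := by
  have hne := bits_succ_ne_nil i
  have : 2 * i + 1 + 1 = 2 * (i + 1) := by ring
  rw [stdEnum, stdEnum, this, Nat.bit0_bits _ (by omega), List.dropLast_cons_of_ne_nil hne,
    List.reverse_cons]

theorem stdEnum_bit1 (i : ℕ) : stdEnum (2 * i + 2) = stdEnum i ++ [true] := by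
  have hne := bits_succ_ne_nil i
  have : 2 * i + 2 + 1 = 2 * (i + 1) + 1 := by ring
  rw [stdEnum, stdEnum, this, Nat.bit1_bits, List.dropLast_cons_of_ne_nil hne,
    List.reverse_cons]

/-- Induction along the binary tree of strings, read through their indices. -/
theorem stdEnum_induction {p : ℕ → Prop} (h0 : p 0) (h1 : ∀ i, p i → p (2 * i + 1))
    (h2 : ∀ i, p i → p (2 * i + 2)) (n : ℕ) : p n := by
  induction n using Nat.strong_induction_on with
  | _ n ih =>
    rcases Nat.eq_zero_or_pos n with rfl | hn
    · exact h0
    · rcases Nat.even_or_odd' n with ⟨k, rfl | rfl⟩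
      · obtain ⟨j, rfl⟩ : ∃ j, k = j + 1 := ⟨k - 1, by omega⟩
        exact h2 j (ih j (by omega))
      · exact h1 k (ih k (by omega))

theorem log2_two_mul_add_two (i : ℕ) : Nat.log2 (2 * i + 1 + 1) = Nat.log2 (i + 1) + 1 := by
  rw [Nat.log2_def, if_pos (by omega)]
  congr 2
  omega

theorem log2_two_mul_add_three (i : ℕ) : Nat.log2 (2 * i + 2 + 1) = Nat.log2 (i + 1) + 1 := by
  rw [Nat.log2_def, if_pos (by omega)]
  congr 2
  omega

theorem length_stdEnum (n : ℕ) : (stdEnum n).length = Nat.log2 (n + 1) := by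
  induction n using stdEnum_induction with
  | h0 => simp [stdEnum_zero, log2_one]
  | h1 i ih => rw [stdEnum_bit0, log2_two_mul_add_two, List.length_append, ih]; rfl
  | h2 i ih => rw [stdEnum_bit1, log2_two_mul_add_three, List.length_append, ih]; rfl

theorem stdEnum_surjective : Function.Surjective stdEnum := by
  intro x
  induction x using List.reverseRecOn with
  | nil => exact ⟨0, stdEnum_zero⟩
  | append_singleton l b ih =>
    obtain ⟨i, rfl⟩ := ih
    cases b
    · exact ⟨_, stdEnum_bit0 i⟩
    · exact ⟨_, stdEnum_bit1 i⟩

theorem stdEnum_injective : Function.Injective stdEnum := by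
  intro m
  induction m using stdEnum_induction with
  | h0 =>
    intro n
    induction n using stdEnum_induction with
    | h0 => simp
    | h1 i _ => simp [stdEnum_zero, stdEnum_bit0]
    | h2 i _ => simp [stdEnum_zero, stdEnum_bit1]
  | h1 j ih =>
    intro n
    induction n using stdEnum_induction with
    | h0 => simp [stdEnum_zero, stdEnum_bit0]
    | h1 i _ =>
      intro h
      simp only [stdEnum_bit0, List.append_left_inj] at h
      rw [ih h]
    | h2 i _ => simp [stdEnum_bit0, stdEnum_bit1]
  | h2 j ih =>
    intro n
    induction n using stdEnum_induction with
    | h0 => simp [stdEnum_zero, stdEnum_bit1]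
    | h1 i _ => simp [stdEnum_bit0, stdEnum_bit1]
    | h2 i _ =>
      intro h
      simp only [stdEnum_bit1, List.append_left_inj] at h
      rw [ih h]

theorem stdEnum_pad (a m : ℕ) :
    stdEnum (2 ^ (Nat.log2 (m + 1) + a) - 2 ^ Nat.log2 (m + 1) + m) =
      List.replicate a false ++ stdEnum m := by
  induction m using stdEnum_induction with
  | h0 =>
    induction a with
    | zero => simp
    | succ a ih =>
      have h1 : 1 ≤ 2 ^ a := Nat.one_le_two_pow
      simp only [zero_add, log2_one, pow_zero, add_zero, stdEnum_zero, List.append_nil] at ih ⊢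
      have : 2 ^ (a + 1) - 1 = 2 * (2 ^ a - 1) + 1 := by rw [pow_succ]; omega
      rw [this, stdEnum_bit0, ih, List.replicate_succ']
  | h1 i ih =>
    rw [log2_two_mul_add_two, stdEnum_bit0, ← List.append_assoc, ← ih, ← stdEnum_bit0]
    congr 1
    rw [show Nat.log2 (i + 1) + 1 + a = Nat.log2 (i + 1) + a + 1 by ring, pow_succ, pow_succ]
    omega
  | h2 i ih =>
    rw [log2_two_mul_add_three, stdEnum_bit1, ← List.append_assoc, ← ih, ← stdEnum_bit1]
    congr 1
    rw [show Nat.log2 (i + 1) + 1 + a = Nat.log2 (i + 1) + a + 1 by ring, pow_succ, pow_succ]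
    omega

/-- The index of the string `0^{2n} s_m`, where `n = |s_m|`. -/
def codePos (m : ℕ) : ℕ :=
  2 ^ (Nat.log2 (m + 1) + 2 * Nat.log2 (m + 1)) - 2 ^ Nat.log2 (m + 1) + m

theorem stdEnum_codePos (m : ℕ) :
    stdEnum (codePos m) = List.replicate (2 * Nat.log2 (m + 1)) false ++ stdEnum m :=
  stdEnum_pad _ m

theorem codePos_zero : codePos 0 = 0 := by simp [codePos, log2_one]

theorem codePos_strictMono : StrictMono codePos := by
  have key : Monotone fun n : ℕ => 2 ^ (n + 2 * n) - 2 ^ n := by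
    intro a b hab
    have e (n : ℕ) : 2 ^ (n + 2 * n) - 2 ^ n = 2 ^ n * (4 ^ n - 1) := by
      rw [Nat.mul_sub, mul_one, pow_add, pow_mul]
      norm_num
    simp only [e]
    gcongr <;> norm_num
  refine strictMono_nat_of_lt_succ fun m => ?_
  have hlog : Nat.log2 (m + 1) ≤ Nat.log2 (m + 1 + 1) := by
    rw [Nat.log2_eq_log_two, Nat.log2_eq_log_two]
    exact Nat.log_mono_right (by omega)
  have := key hlog
  simp only [codePos] at this ⊢
  omega

theorem mem_strsOfLen {n : ℕ} {x : Str} : x ∈ strsOfLen n ↔ x.length = n := by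
  simp only [strsOfLen, Finset.mem_image, Finset.mem_univ, true_and]
  constructor
  · rintro ⟨f, rfl⟩
    simp
  · rintro rfl
    exact ⟨x.get, List.ofFn_get x⟩

theorem card_strsOfLen (n : ℕ) : (strsOfLen n).card = 2 ^ n := by
  rw [strsOfLen, Finset.card_image_of_injective _ List.ofFn_injective]
  simp

theorem card_strsOfLen_head (n : ℕ) (b : Bool) :
    ((strsOfLen (n + 1)).filter (fun x => x.head? = some b)).card = 2 ^ n := by
  have : (strsOfLen (n + 1)).filter (fun x => x.head? = some b) =
      (strsOfLen n).image (List.cons b) := by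
    ext x
    cases x with
    | nil => simp
    | cons a x =>
      simp only [Finset.mem_filter, mem_strsOfLen, Finset.mem_image, List.length_cons,
        List.head?_cons, Option.some.injEq, add_left_inj, List.cons.injEq]
      constructor
      · rintro ⟨h, rfl⟩
        exact ⟨x, h, rfl, rfl⟩
      · rintro ⟨y, h, rfl, rfl⟩
        exact ⟨h, rfl⟩
  rw [this, Finset.card_image_of_injective _ List.cons_injective, card_strsOfLen]

theorem mem_freeSet {g : List Str} {x : Str} :
    x ∈ freeSet g ↔ x.length = (stdEnum g.length).length ∧ x ∉ g := by
  rw [freeSet, Finset.mem_filter, mem_strsOfLen]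

/-- The strings of the current length already used by `g`. -/
def usedSet (g : List Str) : Finset Str :=
  (strsOfLen (stdEnum g.length).length).filter (fun x => x ∈ g)

theorem card_usedSet_le {g : List Str} (hg : IsPPP g) :
    (usedSet g).card + 2 ^ Nat.log2 (g.length + 1) ≤ g.length + 1 := by
  have hpow : 2 ^ Nat.log2 (g.length + 1) ≤ g.length + 1 := Nat.log2_self_le (by omega)
  have hsub : usedSet g ⊆ (Finset.Ico (2 ^ Nat.log2 (g.length + 1) - 1) g.length).image
      (fun i => g.getD i []) := by
    intro x hx
    simp only [usedSet, Finset.mem_filter, mem_strsOfLen] at hx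
    obtain ⟨hlen, hmem⟩ := hx
    obtain ⟨i, hi⟩ := List.mem_iff_get.1 hmem
    have h2 := hg.2 i.1 i.2
    rw [hi, hlen, length_stdEnum, length_stdEnum] at h2
    refine Finset.mem_image.2 ⟨i.1, Finset.mem_Ico.2 ⟨?_, i.2⟩, ?_⟩
    · rw [h2]
      have := Nat.log2_self_le (n := i.1 + 1) (by omega)
      omega
    · rw [← hi]
      simp
  have h1 := (Finset.card_le_card hsub).trans Finset.card_image_le
  rw [Nat.card_Ico] at h1
  omega

theorem card_freeSet_add_card_usedSet (g : List Str) :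
    (freeSet g).card + (usedSet g).card = 2 ^ Nat.log2 (g.length + 1) := by
  rw [← length_stdEnum, ← card_strsOfLen, add_comm, freeSet, usedSet,
    Finset.card_filter_add_card_filter_not]

theorem freeSet_nonempty {g : List Str} (hg : IsPPP g) : (freeSet g).Nonempty := by
  rw [← Finset.card_pos]
  have h1 := card_usedSet_le hg
  have h2 := card_freeSet_add_card_usedSet g
  have h3 := Nat.lt_log2_self (n := g.length + 1)
  rw [pow_succ] at h3
  omega

/-- Free strings whose first bit is `b`. -/
def freeHead (g : List Str) (b : Bool) : Finset Str :=
  (freeSet g).filter (fun x => x.head? = some b)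

theorem le_card_freeHead {g : List Str} {n : ℕ} (hn : Nat.log2 (g.length + 1) = n + 1)
    (b : Bool) : 2 ^ n ≤ (freeHead g b).card + (usedSet g).card := by
  rw [← card_strsOfLen_head n b]
  refine (Finset.card_le_card ?_).trans (Finset.card_union_le _ _)
  intro x hx
  simp only [Finset.mem_filter, mem_strsOfLen] at hx
  simp only [Finset.mem_union, freeHead, usedSet, Finset.mem_filter, mem_freeSet, mem_strsOfLen,
    length_stdEnum, hn]
  tauto

theorem sum_freeSet_eq {g : List Str} {n : ℕ} (hn : Nat.log2 (g.length + 1) = n + 1)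
    (f : Str → ℝ) :
    ∑ x ∈ freeSet g, f x = ∑ x ∈ freeHead g false, f x + ∑ x ∈ freeHead g true, f x := by
  rw [← Finset.sum_filter_add_sum_filter_not (freeSet g) (fun x => x.head? = some false)]
  congr 1
  refine Finset.sum_congr ?_ fun _ _ => rfl
  refine Finset.filter_congr fun x hx => ?_
  have hlen := (mem_freeSet.1 hx).1
  rw [length_stdEnum, hn] at hlen
  cases x with
  | nil => simp at hlen
  | cons a x => cases a <;> simp

/-- A minimizer of `x ↦ d (g ++ [x])` over the finite set `S`. -/
noncomputable def argMin (d : List Str → ℝ) (g : List Str) (S : Finset Str) : Str :=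
  open Classical in
  if h : S.Nonempty then (S.exists_min_image (fun x => d (g ++ [x])) h).choose else []

theorem argMin_mem (d : List Str → ℝ) (g : List Str) {S : Finset Str} (h : S.Nonempty) :
    argMin d g S ∈ S := by
  rw [argMin, dif_pos h]
  exact (S.exists_min_image (fun x => d (g ++ [x])) h).choose_spec.1

theorem argMin_le (d : List Str → ℝ) (g : List Str) {S : Finset Str} {x : Str} (hx : x ∈ S) :
    d (g ++ [argMin d g S]) ≤ d (g ++ [x]) := by
  have h : S.Nonempty := ⟨x, hx⟩
  rw [argMin, dif_pos h]
  exact (S.exists_min_image (fun x => d (g ++ [x])) h).choose_spec.2 x hx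

theorem card_mul_argMin_le (d : List Str → ℝ) (g : List Str) (S : Finset Str) :
    (S.card : ℝ) * d (g ++ [argMin d g S]) ≤ ∑ x ∈ S, d (g ++ [x]) := by
  rw [← nsmul_eq_mul]
  exact Finset.card_nsmul_le_sum _ _ _ fun x hx => argMin_le d g hx

open Classical in
/-- Admissible values at the next position: the first bit is prescribed by `β` at code
positions, and there is no constraint elsewhere. -/
noncomputable def candidates (β : ℕ → Bool) (g : List Str) : Finset Str :=
  (freeSet g).filter (fun x => ∀ m, 0 < m → codePos m = g.length → x.head? = some (β m))

theorem mem_candidates {β : ℕ → Bool} {g : List Str} {x : Str} :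
    x ∈ candidates β g ↔
      x ∈ freeSet g ∧ ∀ m, 0 < m → codePos m = g.length → x.head? = some (β m) := by
  classical
  simp only [candidates, Finset.mem_filter]

theorem candidates_of_not_code (β : ℕ → Bool) {g : List Str}
    (h : ∀ m, 0 < m → codePos m ≠ g.length) : candidates β g = freeSet g := by
  ext x
  rw [mem_candidates]
  exact ⟨And.left, fun hx => ⟨hx, fun m hm e => absurd e (h m hm)⟩⟩

theorem candidates_of_code (β : ℕ → Bool) {g : List Str} {m : ℕ} (hm : 0 < m)
    (h : codePos m = g.length) : candidates β g = freeHead g (β m) := by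
  ext x
  rw [mem_candidates, freeHead, Finset.mem_filter]
  refine and_congr_right fun _ => ⟨fun H => H m hm h, fun H k _ hk => ?_⟩
  rwa [codePos_strictMono.injective (hk.trans h.symm)]

theorem codePos_add_one (m : ℕ) :
    codePos m + 1 = 2 ^ (3 * Nat.log2 (m + 1)) + (m + 1 - 2 ^ Nat.log2 (m + 1)) := by
  have h1 := Nat.log2_self_le (n := m + 1) (by omega)
  have h2 : 2 ^ Nat.log2 (m + 1) ≤ 2 ^ (3 * Nat.log2 (m + 1)) :=
    Nat.pow_le_pow_right (by norm_num) (by omega)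
  rw [codePos, show Nat.log2 (m + 1) + 2 * Nat.log2 (m + 1) = 3 * Nat.log2 (m + 1) by ring]
  omega

theorem log2_codePos (m : ℕ) : Nat.log2 (codePos m + 1) = 3 * Nat.log2 (m + 1) := by
  rw [← length_stdEnum, stdEnum_codePos, List.length_append, length_stdEnum,
    List.length_replicate]
  ring

theorem log2_pos {m : ℕ} (hm : 0 < m) : 0 < Nat.log2 (m + 1) := by
  by_contra h
  have := Nat.lt_log2_self (n := m + 1)
  rw [Nat.eq_zero_of_not_pos h] at this
  omega

/-- At the code position of `s_m`, few strings have been used so far. -/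
theorem card_usedSet_code {g : List Str} (hg : IsPPP g) {m : ℕ} (h : codePos m = g.length) :
    (usedSet g).card + 2 ^ Nat.log2 (m + 1) ≤ m + 1 := by
  have h1 := card_usedSet_le hg
  have h2 := codePos_add_one m
  have h3 := Nat.log2_self_le (n := m + 1) (by omega)
  rw [← h, log2_codePos] at h1
  omega

theorem freeHead_nonempty {g : List Str} (hg : IsPPP g) {m : ℕ} (hm : 0 < m)
    (h : codePos m = g.length) (b : Bool) : (freeHead g b).Nonempty := by
  have hpos := log2_pos hm
  have h1 := card_usedSet_code hg h
  have h2 := Nat.lt_log2_self (n := m + 1)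
  have h4 : 2 ^ Nat.log2 (m + 1) ≤ 2 ^ (3 * Nat.log2 (m + 1) - 1) :=
    Nat.pow_le_pow_right (by norm_num) (by omega)
  have h3 := le_card_freeHead (g := g) (n := 3 * Nat.log2 (m + 1) - 1)
    (by rw [← h, log2_codePos]; omega) b
  rw [← Finset.card_pos]
  rw [pow_succ] at h2
  omega

theorem candidates_nonempty (β : ℕ → Bool) {g : List Str} (hg : IsPPP g) :
    (candidates β g).Nonempty := by
  by_cases h : ∃ m, 0 < m ∧ codePos m = g.length
  · obtain ⟨m, hm, e⟩ := h
    rw [candidates_of_code β hm e]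
    exact freeHead_nonempty hg hm e _
  · push Not at h
    rw [candidates_of_not_code β h]
    exact freeSet_nonempty hg

theorem isPPP_append {g : List Str} (hg : IsPPP g) {x : Str} (hx : x ∈ freeSet g) :
    IsPPP (g ++ [x]) := by
  obtain ⟨h1, h2⟩ := mem_freeSet.1 hx
  refine ⟨?_, fun i hi => ?_⟩
  · rw [List.nodup_append]
    refine ⟨hg.1, List.nodup_singleton x, ?_⟩
    rintro a ha b hb rfl
    rw [List.mem_singleton] at hb
    exact h2 (hb ▸ ha)
  · rcases Nat.lt_or_ge i g.length with hlt | hge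
    · have := hg.2 i hlt
      simpa [List.getElem_append_left hlt] using this
    · have : i = g.length := by simp at hi; omega
      subst this
      simpa using h1

/-- The prefixes of the permutation coding `β` along which `d` grows the least. -/
noncomputable def greedy (d : List Str → ℝ) (β : ℕ → Bool) : ℕ → List Str
  | 0 => []
  | N + 1 => greedy d β N ++ [argMin d (greedy d β N) (candidates β (greedy d β N))]

/-- The value of the greedy permutation at `s_N`. -/
noncomputable def greedyVal (d : List Str → ℝ) (β : ℕ → Bool) (N : ℕ) : Str :=
  argMin d (greedy d β N) (candidates β (greedy d β N))

theorem greedy_succ (d : List Str → ℝ) (β : ℕ → Bool) (N : ℕ) :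
    greedy d β (N + 1) = greedy d β N ++ [greedyVal d β N] := rfl

theorem length_greedy (d : List Str → ℝ) (β : ℕ → Bool) (N : ℕ) :
    (greedy d β N).length = N := by
  induction N with
  | zero => rfl
  | succ N ih => rw [greedy_succ, List.length_append, ih]; rfl

theorem isPPP_greedy (d : List Str → ℝ) (β : ℕ → Bool) (N : ℕ) : IsPPP (greedy d β N) := by
  induction N with
  | zero => exact ⟨List.nodup_nil, fun i h => absurd h (by simp [greedy])⟩
  | succ N ih =>
    exact isPPP_append ih (mem_candidates.1 (argMin_mem d _ (candidates_nonempty β ih))).1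

theorem greedyVal_mem (d : List Str → ℝ) (β : ℕ → Bool) (N : ℕ) :
    greedyVal d β N ∈ candidates β (greedy d β N) :=
  argMin_mem d _ (candidates_nonempty β (isPPP_greedy d β N))

theorem length_greedyVal (d : List Str → ℝ) (β : ℕ → Bool) (N : ℕ) :
    (greedyVal d β N).length = (stdEnum N).length := by
  have := (mem_freeSet.1 (mem_candidates.1 (greedyVal_mem d β N)).1).1
  rwa [length_greedy] at this

theorem head_greedyVal (d : List Str → ℝ) (β : ℕ → Bool) {m : ℕ} (hm : 0 < m) :
    (greedyVal d β (codePos m)).head? = some (β m) :=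
  (mem_candidates.1 (greedyVal_mem d β (codePos m))).2 m hm (length_greedy d β _).symm

theorem greedy_eq_map (d : List Str → ℝ) (β : ℕ → Bool) (N : ℕ) :
    greedy d β N = (List.range N).map (greedyVal d β) := by
  induction N with
  | zero => rfl
  | succ N ih => rw [greedy_succ, List.range_succ, List.map_append, ← ih]; rfl

theorem greedyVal_injective (d : List Str → ℝ) (β : ℕ → Bool) :
    Function.Injective (greedyVal d β) := by
  intro i j hij
  have hnd := (isPPP_greedy d β (max i j + 1)).1
  rw [greedy_eq_map] at hnd
  exact List.inj_on_of_nodup_map hnd (List.mem_range.2 (by omega)) (List.mem_range.2 (by omega)) hij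

/-- The index of a string in the standard enumeration. -/
noncomputable def strIndex : Str → ℕ := Function.surjInv stdEnum_surjective

theorem stdEnum_strIndex (x : Str) : stdEnum (strIndex x) = x :=
  Function.surjInv_eq stdEnum_surjective x

theorem strIndex_stdEnum (n : ℕ) : strIndex (stdEnum n) = n :=
  stdEnum_injective (stdEnum_strIndex _)

theorem length_greedyVal_strIndex (d : List Str → ℝ) (β : ℕ → Bool) (x : Str) :
    (greedyVal d β (strIndex x)).length = x.length := by
  rw [length_greedyVal, stdEnum_strIndex]

/-- An injective length-preserving map on strings is surjective. -/
theorem surjective_of_injective_of_length {f : Str → Str} (hf : Function.Injective f)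
    (hlen : ∀ x, (f x).length = x.length) : Function.Surjective f := by
  intro y
  have := Finset.surjOn_of_injOn_of_card_le (s := strsOfLen y.length) (t := strsOfLen y.length) f
    (fun x hx => by
      rw [Finset.mem_coe, mem_strsOfLen] at hx ⊢
      rw [hlen, hx]) hf.injOn le_rfl
  obtain ⟨x, -, hx⟩ := this (Finset.mem_coe.2 (mem_strsOfLen.2 rfl))
  exact ⟨x, hx⟩

theorem strIndex_injective : Function.Injective strIndex :=
  Function.injective_surjInv stdEnum_surjective

theorem greedyVal_strIndex_bijective (d : List Str → ℝ) (β : ℕ → Bool) :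
    Function.Bijective fun x => greedyVal d β (strIndex x) := by
  have hinj : Function.Injective fun x => greedyVal d β (strIndex x) :=
    fun _ _ h => strIndex_injective (greedyVal_injective d β h)
  exact ⟨hinj, surjective_of_injective_of_length hinj (length_greedyVal_strIndex d β)⟩

/-- The greedy permutation coding `β`. -/
noncomputable def greedyPerm (d : List Str → ℝ) (β : ℕ → Bool) : LPPerm where
  toFun x := greedyVal d β (strIndex x)
  bij := greedyVal_strIndex_bijective d β
  lenPres := length_greedyVal_strIndex d β

theorem restrict_greedyPerm (d : List Str → ℝ) (β : ℕ → Bool) (N : ℕ) :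
    (greedyPerm d β).restrict N = greedy d β N := by
  simp only [LPPerm.restrict, greedyPerm, strIndex_stdEnum, greedy_eq_map]

theorem greedyPerm_mem_PiL (d : List Str → ℝ) {β : ℕ → Bool} {L : Set Str}
    (h : ∀ m, β m = true ↔ stdEnum m ∈ L) : greedyPerm d β ∈ PiL L := by
  intro n hn x hx
  obtain ⟨m, rfl⟩ := stdEnum_surjective x
  have hm : 0 < m := by
    rcases Nat.eq_zero_or_pos m with rfl | hm
    · rw [stdEnum_zero, List.length_nil] at hx
      omega
    · exact hm
  rw [length_stdEnum] at hx
  rw [← hx, ← stdEnum_codePos, ← h]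
  simp only [greedyPerm, strIndex_stdEnum, head_greedyVal d β hm, Option.some.injEq]

theorem greedy_congr (d : List Str → ℝ) {β γ : ℕ → Bool} {k : ℕ} (h : ∀ i < k, β i = γ i)
    {N : ℕ} (hN : N ≤ codePos k) : greedy d β N = greedy d γ N := by
  induction N with
  | zero => rfl
  | succ N ih =>
    have e := ih (by omega)
    have hc : candidates β (greedy d γ N) = candidates γ (greedy d γ N) := by
      ext x
      rw [mem_candidates, mem_candidates]
      refine and_congr_right fun _ => forall_congr' fun m => imp_congr_right fun _ =>
        imp_congr_right fun hm => ?_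
      rw [length_greedy] at hm
      rw [h m (codePos_strictMono.lt_iff_lt.1 (by omega))]
    rw [greedy, greedy, e, hc]

theorem IsPermMartingale.card_mul_eq {d : List Str → ℝ} (hd : IsPermMartingale d) {g : List Str}
    (hg : IsPPP g) : ((freeSet g).card : ℝ) * d g = ∑ x ∈ freeSet g, d (g ++ [x]) := by
  have h0 : ((freeSet g).card : ℝ) ≠ 0 :=
    Nat.cast_ne_zero.2 (Finset.card_pos.2 (freeSet_nonempty hg)).ne'
  rw [hd.2 g hg]
  field_simp

theorem IsPermMartingale.greedy_succ_le {d : List Str → ℝ} (hd : IsPermMartingale d)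
    (β : ℕ → Bool) {N : ℕ} (hN : ∀ m, 0 < m → codePos m ≠ N) :
    d (greedy d β (N + 1)) ≤ d (greedy d β N) := by
  have hg := isPPP_greedy d β N
  have h1 := card_mul_argMin_le d (greedy d β N) (freeSet (greedy d β N))
  rw [← hd.card_mul_eq hg] at h1
  rw [greedy, candidates_of_not_code β (by rwa [length_greedy])]
  exact le_of_mul_le_mul_left h1 (Nat.cast_pos.2 (Finset.card_pos.2 (freeSet_nonempty hg)))

/-- The length of the greedy prefix which has just coded the first `k` bits. -/
def codedLen : ℕ → ℕ
  | 0 => 0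
  | k + 1 => codePos k + 1

theorem codedLen_le_codePos (k : ℕ) : codedLen k ≤ codePos k := by
  cases k with
  | zero => exact Nat.zero_le _
  | succ k => exact codePos_strictMono (Nat.lt_succ_self k)

theorem not_code_of_codedLen_le {k N : ℕ} (h1 : codedLen k ≤ N) (h2 : N < codePos k) (m : ℕ) :
    codePos m ≠ N := by
  rintro rfl
  have hm := codePos_strictMono.lt_iff_lt.1 h2
  cases k with
  | zero => omega
  | succ k =>
    have := codePos_strictMono.monotone (Nat.le_of_lt_succ hm)
    simp only [codedLen] at h1
    omega

theorem IsPermMartingale.greedy_le_codedLen {d : List Str → ℝ} (hd : IsPermMartingale d)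
    (β : ℕ → Bool) {k N : ℕ} (h1 : codedLen k ≤ N) (h2 : N ≤ codePos k) :
    d (greedy d β N) ≤ d (greedy d β (codedLen k)) := by
  induction N, h1 using Nat.le_induction with
  | base => exact le_rfl
  | succ N h1 ih =>
    exact (hd.greedy_succ_le β fun m _ => not_code_of_codedLen_le h1 h2 m).trans (ih (by omega))

theorem exists_codedLen_le {k N : ℕ} (h : codedLen k ≤ N) :
    ∃ j, k ≤ j ∧ codedLen j ≤ N ∧ N ≤ codePos j := by
  induction N, h using Nat.le_induction with
  | base => exact ⟨k, le_rfl, le_rfl, codedLen_le_codePos k⟩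
  | succ N _ ih =>
    obtain ⟨j, hj, h1, h2⟩ := ih
    rcases h2.eq_or_lt with rfl | h2
    · exact ⟨j + 1, by omega, le_rfl, codedLen_le_codePos (j + 1)⟩
    · exact ⟨j, hj, by omega, h2⟩

/-- Weights absorbing the bias of sampling without replacement. -/
noncomputable def weight (k : ℕ) : ℝ := 1 + 8 / (k + 1)

theorem one_le_weight (k : ℕ) : 1 ≤ weight k := by
  rw [weight]
  have : (0 : ℝ) ≤ 8 / (k + 1) := by positivity
  linarith

theorem weight_succ_mul_le {M r : ℝ} {k : ℕ} (hM : 2 ≤ M) (hr : 0 ≤ r) (hrM : r + 1 ≤ M)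
    {u : ℝ} (hu : u ≤ r) (hk : (k : ℝ) + 1 = M + r) :
    weight (k + 1) * (M ^ 3 - u) ≤ weight k * (M ^ 3 - 2 * u) := by
  have hs : (0 : ℝ) < M + r := by linarith
  have key : r * ((M + r) ^ 2 + 9 * (M + r) + 16) ≤ 8 * M ^ 3 := by
    have h1 : r * ((M + r) ^ 2 + 9 * (M + r) + 16) ≤
        (M - 1) * ((M + (M - 1)) ^ 2 + 9 * (M + (M - 1)) + 16) := by
      have : r ≤ M - 1 := by linarith
      gcongr
      linarith
    nlinarith [mul_nonneg (sub_nonneg.2 hM) (sub_nonneg.2 hM),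
      mul_nonneg (mul_nonneg (sub_nonneg.2 hM) (sub_nonneg.2 hM)) (sub_nonneg.2 hM)]
  have key' : u * ((M + r) ^ 2 + 9 * (M + r) + 16) ≤ 8 * M ^ 3 :=
    (mul_le_mul_of_nonneg_right hu (by positivity)).trans key
  have e1 : weight k = (M + r + 8) / (M + r) := by
    rw [weight, hk]
    field_simp
  have e2 : weight (k + 1) = (M + r + 9) / (M + r + 1) := by
    rw [weight, Nat.cast_add, Nat.cast_one, hk]
    field_simp
    ring
  rw [e1, e2, div_mul_eq_mul_div, div_mul_eq_mul_div, div_le_div_iff₀ (by linarith) hs]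
  nlinarith [key']

theorem IsPermMartingale.weight_mul_argMin_le {d : List Str → ℝ} (hd : IsPermMartingale d)
    {g : List Str} (hg : IsPPP g) {m : ℕ} (hm : 0 < m) (h : codePos m = g.length) :
    weight (m + 1) * (d (g ++ [argMin d g (freeHead g false)]) +
      d (g ++ [argMin d g (freeHead g true)])) ≤ 2 * (weight m * d g) := by
  obtain ⟨n, hn⟩ : ∃ n, 3 * Nat.log2 (m + 1) = n + 1 :=
    ⟨3 * Nat.log2 (m + 1) - 1, by have := log2_pos hm; omega⟩
  have hlog : Nat.log2 (g.length + 1) = n + 1 := by rw [← h, log2_codePos, hn]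
  set x := d (g ++ [argMin d g (freeHead g false)])
  set y := d (g ++ [argMin d g (freeHead g true)])
  have hx : 0 ≤ x := hd.1 _
  have hy : 0 ≤ y := hd.1 _
  have hsum := hd.card_mul_eq hg
  rw [sum_freeSet_eq hlog] at hsum
  have h0 := card_mul_argMin_le d g (freeHead g false)
  have h1 := card_mul_argMin_le d g (freeHead g true)
  have c0 := le_card_freeHead hlog false
  have c1 := le_card_freeHead hlog true
  have cf := card_freeSet_add_card_usedSet g
  rw [hlog] at cf
  have cu := card_usedSet_code hg h
  have hlt := Nat.lt_log2_self (n := m + 1)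
  have hMle : 2 ≤ 2 ^ Nat.log2 (m + 1) := by
    calc 2 = 2 ^ 1 := rfl
      _ ≤ _ := Nat.pow_le_pow_right (by norm_num) (log2_pos hm)
  have hM3 : (2 : ℝ) ^ (n + 1) = ((2 : ℝ) ^ Nat.log2 (m + 1)) ^ 3 := by
    rw [← hn, ← pow_mul, mul_comm]
  rw [pow_succ] at hlt
  have hcu : ((usedSet g).card : ℝ) + 2 ^ Nat.log2 (m + 1) ≤ m + 1 := by exact_mod_cast cu
  have hlt' : (m : ℝ) + 1 + 1 ≤ 2 ^ Nat.log2 (m + 1) * 2 := by exact_mod_cast hlt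
  have hw := weight_succ_mul_le (k := m) (M := 2 ^ Nat.log2 (m + 1))
    (r := m + 1 - 2 ^ Nat.log2 (m + 1)) (u := (usedSet g).card)
    (by exact_mod_cast hMle) (by linarith [Nat.cast_nonneg (α := ℝ) (usedSet g).card])
    (by linarith) (by linarith) (by ring)
  rw [← hM3] at hw
  have cf' : ((freeSet g).card : ℝ) + (usedSet g).card = 2 ^ (n + 1) := by exact_mod_cast cf
  have c0' : (2 : ℝ) ^ n ≤ (freeHead g false).card + (usedSet g).card := by exact_mod_cast c0
  have c1' : (2 : ℝ) ^ n ≤ (freeHead g true).card + (usedSet g).card := by exact_mod_cast c1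
  have hpow : (2 : ℝ) ^ (n + 1) = 2 * 2 ^ n := by ring
  have hF : (0 : ℝ) < (freeSet g).card :=
    Nat.cast_pos.2 (Finset.card_pos.2 (freeSet_nonempty hg))
  have hwm : 0 ≤ weight m := zero_le_one.trans (one_le_weight m)
  have step : (2 ^ n - ((usedSet g).card : ℝ)) * (x + y) ≤ (freeSet g).card * d g := by
    rw [hsum, mul_add]
    exact add_le_add
      ((mul_le_mul_of_nonneg_right (by linarith) hx).trans h0)
      ((mul_le_mul_of_nonneg_right (by linarith) hy).trans h1)
  refine le_of_mul_le_mul_left ?_ hF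
  calc ((freeSet g).card : ℝ) * (weight (m + 1) * (x + y))
      = weight (m + 1) * (2 ^ (n + 1) - (usedSet g).card) * (x + y) := by rw [← cf']; ring
    _ ≤ weight m * (2 ^ (n + 1) - 2 * (usedSet g).card) * (x + y) :=
        mul_le_mul_of_nonneg_right hw (add_nonneg hx hy)
    _ = 2 * weight m * ((2 ^ n - (usedSet g).card) * (x + y)) := by rw [hpow]; ring
    _ ≤ 2 * weight m * ((freeSet g).card * d g) :=
        mul_le_mul_of_nonneg_left step (by positivity)
    _ = (freeSet g).card * (2 * (weight m * d g)) := by ring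

/-- The bits of `w`, continued by zeros. -/
def bitsOf (w : List Bool) (i : ℕ) : Bool := w.getD i false

theorem bitsOf_append_of_lt (w v : List Bool) {i : ℕ} (h : i < w.length) :
    bitsOf (w ++ v) i = bitsOf w i := by
  rw [bitsOf, bitsOf, List.getD_append _ _ _ _ h]

theorem bitsOf_append_length (w : List Bool) (b : Bool) : bitsOf (w ++ [b]) w.length = b := by
  simp [bitsOf]

/-- The weighted capital of `d` along the greedy permutation coding `w`. -/
noncomputable def greedyCapital (d : List Str → ℝ) (w : List Bool) : ℝ :=
  weight w.length * d (greedy d (bitsOf w) (codedLen w.length))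

theorem greedyCapital_nonneg {d : List Str → ℝ} (hd : IsPermMartingale d) (w : List Bool) :
    0 ≤ greedyCapital d w :=
  mul_nonneg (zero_le_one.trans (one_le_weight _)) (hd.1 _)

theorem greedyCapital_append (d : List Str → ℝ) (w : List Bool) (b : Bool) :
    greedyCapital d (w ++ [b]) = weight (w.length + 1) *
      d (greedy d (bitsOf w) (codePos w.length) ++
        [argMin d (greedy d (bitsOf w) (codePos w.length))
          (candidates (bitsOf (w ++ [b])) (greedy d (bitsOf w) (codePos w.length)))]) := by
  have e := greedy_congr d (β := bitsOf (w ++ [b])) (γ := bitsOf w) (k := w.length)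
    (fun i hi => bitsOf_append_of_lt w [b] hi) le_rfl
  rw [greedyCapital, List.length_append, List.length_singleton, codedLen, greedy, e]

theorem greedyCapital_supermartingale {d : List Str → ℝ} (hd : IsPermMartingale d)
    (w : List Bool) :
    (greedyCapital d (w ++ [false]) + greedyCapital d (w ++ [true])) / 2 ≤ greedyCapital d w := by
  have hg := isPPP_greedy d (bitsOf w) (codePos w.length)
  have hlen := length_greedy d (bitsOf w) (codePos w.length)
  have hle := hd.greedy_le_codedLen (bitsOf w) (codedLen_le_codePos w.length) le_rfl
  have hw : 0 ≤ weight w.length := zero_le_one.trans (one_le_weight _)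
  have hcap : weight w.length * d (greedy d (bitsOf w) (codePos w.length)) ≤ greedyCapital d w :=
    mul_le_mul_of_nonneg_left hle hw
  rw [greedyCapital_append, greedyCapital_append]
  rcases Nat.eq_zero_or_pos w.length with h0 | hpos
  · obtain rfl := List.eq_nil_of_length_eq_zero h0
    have hN : ∀ m, 0 < m → codePos m ≠ codePos ([] : List Bool).length := fun m hm e =>
      hm.ne' (codePos_strictMono.injective e)
    have hs := hd.greedy_succ_le (bitsOf []) hN
    rw [greedy, candidates_of_not_code _ (by rwa [hlen])] at hs
    rw [candidates_of_not_code _ (by rwa [hlen]), candidates_of_not_code _ (by rwa [hlen])]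
    have hw1 : weight ([] : List Bool).length = 9 := by norm_num [weight]
    have hw2 : weight (([] : List Bool).length + 1) = 5 := by norm_num [weight]
    rw [hw1] at hcap
    rw [hw2]
    linarith [hd.1 (greedy d (bitsOf []) (codePos ([] : List Bool).length))]
  · have h := hd.weight_mul_argMin_le hg hpos hlen.symm
    rw [candidates_of_code _ hpos hlen.symm, candidates_of_code _ hpos hlen.symm,
      bitsOf_append_length, bitsOf_append_length]
    linarith

/-- The martingale dominating a supermartingale `f`, for words read from the last bit. -/
noncomputable def compensateRev (f : List Bool → ℝ) : List Bool → ℝ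
  | [] => f []
  | b :: v => f (v.reverse ++ [b]) +
      (compensateRev f v - (f (v.reverse ++ [false]) + f (v.reverse ++ [true])) / 2)

theorem le_compensateRev {f : List Bool → ℝ}
    (hf : ∀ w, (f (w ++ [false]) + f (w ++ [true])) / 2 ≤ f w) (v : List Bool) :
    f v.reverse ≤ compensateRev f v := by
  induction v with
  | nil => exact le_rfl
  | cons b v ih =>
    rw [compensateRev, List.reverse_cons]
    linarith [hf v.reverse]

/-- Every nonnegative supermartingale is dominated by a martingale. -/
theorem exists_martingale_ge {f : List Bool → ℝ} (h0 : ∀ w, 0 ≤ f w)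
    (hf : ∀ w, (f (w ++ [false]) + f (w ++ [true])) / 2 ≤ f w) :
    ∃ D : List Bool → ℝ, IsMartingale D ∧ ∀ w, f w ≤ D w := by
  have hle (w : List Bool) : f w ≤ compensateRev f w.reverse := by
    simpa using le_compensateRev hf w.reverse
  refine ⟨fun w => compensateRev f w.reverse, ⟨fun w => (h0 w).trans (hle w), fun w => ?_⟩, hle⟩
  simp only [List.reverse_append, List.reverse_singleton, List.singleton_append, compensateRev,
    List.reverse_reverse]
  ring

theorem bitsOf_charPrefix (L : Set Str) {i k : ℕ} (h : i < k) :
    bitsOf (charPrefix L k) i = true ↔ stdEnum i ∈ L := by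
  simp [bitsOf, charPrefix, h]

theorem length_charPrefix (L : Set Str) (k : ℕ) : (charPrefix L k).length = k := by
  simp [charPrefix]

theorem le_greedyCapital_charPrefix {d : List Str → ℝ} (hd : IsPermMartingale d) {β : ℕ → Bool}
    {L : Set Str} (hβ : ∀ m, β m = true ↔ stdEnum m ∈ L) (k : ℕ) :
    d (greedy d β (codedLen k)) ≤ greedyCapital d (charPrefix L k) := by
  have e : greedy d (bitsOf (charPrefix L k)) (codedLen k) = greedy d β (codedLen k) :=
    greedy_congr d (fun i hi => Bool.eq_iff_iff.2
      ((bitsOf_charPrefix L hi).trans (hβ i).symm)) (codedLen_le_codePos k)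
  rw [greedyCapital, length_charPrefix, e]
  exact le_mul_of_one_le_left (hd.1 _) (one_le_weight k)

/-- if a permutation martingale `d` succeeds on every permutation in `Π_X`,
then there is a classical martingale `D` succeeding on every language `L ∈ X`. -/
theorem stmt14 (X : Set (Set Str)) (d : List Str → ℝ) (hd : IsPermMartingale d)
    (h : ∀ π ∈ PiX X, succeedsOn d π) :
    ∃ D : List Bool → ℝ, IsMartingale D ∧ ∀ L ∈ X, succeedsOnLang D L := by
  obtain ⟨D, hD, hle⟩ := exists_martingale_ge (greedyCapital_nonneg hd)
    (greedyCapital_supermartingale hd)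
  refine ⟨D, hD, fun L hL C => ?_⟩
  classical
  have hβ : ∀ m, decide (stdEnum m ∈ L) = true ↔ stdEnum m ∈ L := fun m => decide_eq_true_iff
  have hs := h _ (Set.mem_biUnion hL (greedyPerm_mem_PiL d hβ)) C
  rw [frequently_atTop] at hs ⊢
  intro k
  obtain ⟨N, hN, hC⟩ := hs (codedLen k)
  rw [restrict_greedyPerm] at hC
  obtain ⟨j, hj, h1, h2⟩ := exists_codedLen_le hN
  exact ⟨j, hj, hC.trans_le ((hd.greedy_le_codedLen _ h1 h2).trans
    ((le_greedyCapital_charPrefix hd hβ j).trans (hle _)))⟩
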